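/- The graphons W_{S¹}(x, y) = 1/2 + (1/8)·cos(d_{S¹}(x, y)) + (1/8)·cos(2·d_{S¹}(x, y)) on the circle S¹ with uniform probability measure, and W_{S³}(x, y) = 1/2 + (1/4)·⟨x, y⟩ on the sphere S³ ⊂ ℝ⁴ with uniform probability measure, are isospectral: their integral operators T_{W_{S¹}} and T_{W_{S³}} have the same spectrum {0, 1/2, 1/16}, and for every nonzero eigenvalue the eigenspaces have equal dimensions (1 for the eigenvalue 1/2 and 4 for the eigenvalue 1/16). -/

import Mathlib

open MeasureTheory
open scoped RealInnerProductSpace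

/-- The uniform (normalized surface) probability measure on the unit sphere of a Euclidean
space. -/
noncomputable def sphereUniform (d : ℕ) :
    Measure (Metric.sphere (0 : EuclideanSpace ℝ (Fin d)) 1) :=
  (((volume : Measure (EuclideanSpace ℝ (Fin d))).toSphere Set.univ)⁻¹) •
    (volume : Measure (EuclideanSpace ℝ (Fin d))).toSphere

/-- The geodesic distance on the unit sphere: `d(x,y) = arccos ⟨x,y⟩`. -/
noncomputable def geodesic {d : ℕ} (x y : Metric.sphere (0 : EuclideanSpace ℝ (Fin d)) 1) :
    ℝ :=
  Real.arccos ⟪(x : EuclideanSpace ℝ (Fin d)), (y : EuclideanSpace ℝ (Fin d))⟫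

/-- The graphon `W_{S¹}(x,y) = 1/2 + (1/8)cos(d(x,y)) + (1/8)cos(2 d(x,y))` on the circle. -/
noncomputable def WS1 (x y : Metric.sphere (0 : EuclideanSpace ℝ (Fin 2)) 1) : ℝ :=
  1 / 2 + (1 / 8) * Real.cos (geodesic x y) + (1 / 8) * Real.cos (2 * geodesic x y)

/-- The graphon `W_{S³}(x,y) = 1/2 + (1/4)⟨x,y⟩` on the sphere `S³ ⊂ ℝ⁴`. -/
noncomputable def WS3 (x y : Metric.sphere (0 : EuclideanSpace ℝ (Fin 4)) 1) : ℝ :=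
  1 / 2 + (1 / 4) * ⟪(x : EuclideanSpace ℝ (Fin 4)), (y : EuclideanSpace ℝ (Fin 4))⟫

/-- `lam` is an eigenvalue of the integral operator `T_W` on `L²(Ω, μ)`. -/
def IsEigenvalue {Ω : Type*} [MeasurableSpace Ω] (μ : Measure Ω)
    (W : Ω → Ω → ℝ) (lam : ℝ) : Prop :=
  ∃ f : Ω → ℝ, MemLp f 2 μ ∧ ¬ (f =ᵐ[μ] 0) ∧
    ∀ᵐ x ∂μ, (∫ y, W x y * f y ∂μ) = lam * f x

/-- The eigenspace of `T_W` for `lam` has dimension at least `n`. -/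
def HasEigenFamily {Ω : Type*} [MeasurableSpace Ω] (μ : Measure Ω)
    (W : Ω → Ω → ℝ) (lam : ℝ) (n : ℕ) : Prop :=
  ∃ f : Fin n → Ω → ℝ, (∀ i, MemLp (f i) 2 μ) ∧
    (∀ i, ∀ᵐ x ∂μ, (∫ y, W x y * f i y ∂μ) = lam * f i x) ∧
    ∀ c : Fin n → ℝ, (∀ᵐ x ∂μ, (∑ i, c i * f i x) = 0) → c = 0

open scoped Pointwise

/-- `W` is the finite-rank kernel `∑ i, a i • (e i ⊗ e i)` for an orthonormal family `e` in
`L²(μ)`. -/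
structure IsOrthonormalExpansion {Ω ι : Type*} [MeasurableSpace Ω] [Fintype ι] [DecidableEq ι]
    (μ : Measure Ω) (W : Ω → Ω → ℝ) (a : ι → ℝ) (e : ι → Ω → ℝ) : Prop where
  memLp : ∀ i, MemLp (e i) 2 μ
  orthonormal : ∀ i j, ∫ x, e i x * e j x ∂μ = if i = j then 1 else 0
  kernel_eq : ∀ x y, W x y = ∑ i, a i * (e i x * e i y)

namespace IsOrthonormalExpansion

variable {Ω ι : Type*} [MeasurableSpace Ω] [Fintype ι] [DecidableEq ι]
  {μ : Measure Ω} {W : Ω → Ω → ℝ} {a : ι → ℝ} {e : ι → Ω → ℝ}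

theorem integral_kernel_mul (h : IsOrthonormalExpansion μ W a e) {f : Ω → ℝ}
    (hf : MemLp f 2 μ) (x : Ω) :
    ∫ y, W x y * f y ∂μ = ∑ i, a i * (∫ y, e i y * f y ∂μ) * e i x := by
  have key : ∀ y, W x y * f y = ∑ i, a i * e i x * (e i y * f y) := fun y => by
    rw [h.kernel_eq, Finset.sum_mul]
    exact Finset.sum_congr rfl fun i _ => by ring
  simp_rw [key]
  have hint : ∀ i, Integrable (fun y => a i * e i x * (e i y * f y)) μ := fun i =>
    ((h.memLp i).integrable_mul hf).const_mul _
  rw [integral_finsetSum _ fun i _ => hint i]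
  refine Finset.sum_congr rfl fun i _ => ?_
  rw [integral_const_mul]
  ring

theorem integral_mul_sum (h : IsOrthonormalExpansion μ W a e) (c : ι → ℝ) (i : ι) :
    ∫ y, e i y * ∑ j, c j * e j y ∂μ = c i := by
  have key : ∀ y, e i y * ∑ j, c j * e j y = ∑ j, c j * (e i y * e j y) := fun y => by
    rw [Finset.mul_sum]
    exact Finset.sum_congr rfl fun j _ => by ring
  simp_rw [key]
  have hint : ∀ j, Integrable (fun y => c j * (e i y * e j y)) μ := fun j =>
    ((h.memLp i).integrable_mul (h.memLp j)).const_mul _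
  rw [integral_finsetSum _ fun j _ => hint j]
  simp [integral_const_mul, h.orthonormal]

theorem eq_zero_of_sum_ae_eq_zero (h : IsOrthonormalExpansion μ W a e) {c : ι → ℝ}
    (hc : ∀ᵐ x ∂μ, ∑ i, c i * e i x = 0) : c = 0 := by
  funext i
  rw [← h.integral_mul_sum c i, integral_eq_zero_of_ae]
  · rfl
  · filter_upwards [hc] with x hx
    simp [hx]

theorem integral_kernel_mul_self (h : IsOrthonormalExpansion μ W a e) (i : ι) (x : Ω) :
    ∫ y, W x y * e i y ∂μ = a i * e i x := by
  simp [h.integral_kernel_mul (h.memLp i), h.orthonormal]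

theorem coeff_eq (h : IsOrthonormalExpansion μ W a e) {f : Ω → ℝ} {lam : ℝ}
    (hf : MemLp f 2 μ) (hlam : ∀ᵐ x ∂μ, (∫ y, W x y * f y ∂μ) = lam * f x) (i : ι) :
    a i * (∫ y, e i y * f y ∂μ) = lam * ∫ y, e i y * f y ∂μ := by
  rw [← h.integral_mul_sum (fun i => a i * ∫ y, e i y * f y ∂μ) i, ← integral_const_mul]
  refine integral_congr_ae ?_
  filter_upwards [hlam] with x hx
  rw [h.integral_kernel_mul hf] at hx
  rw [hx]
  ring

theorem eigenfunction_ae_eq (h : IsOrthonormalExpansion μ W a e) {f : Ω → ℝ} {lam : ℝ}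
    (h0 : lam ≠ 0) (hf : MemLp f 2 μ)
    (hlam : ∀ᵐ x ∂μ, (∫ y, W x y * f y ∂μ) = lam * f x) :
    ∀ᵐ x ∂μ, f x = ∑ i, (∫ y, e i y * f y ∂μ) * e i x := by
  filter_upwards [hlam] with x hx
  rw [h.integral_kernel_mul hf] at hx
  simp_rw [h.coeff_eq hf hlam, mul_assoc, ← Finset.mul_sum] at hx
  exact (mul_left_cancel₀ h0 hx).symm

theorem isEigenvalue_iff (h : IsOrthonormalExpansion μ W a e) {lam : ℝ} (h0 : lam ≠ 0) :
    IsEigenvalue μ W lam ↔ ∃ i, a i = lam := by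
  constructor
  · rintro ⟨f, hf, hne, hlam⟩
    by_contra! hcon
    refine hne ?_
    filter_upwards [h.eigenfunction_ae_eq h0 hf hlam] with x hx
    rw [hx]
    refine Finset.sum_eq_zero fun i _ => ?_
    rw [(mul_eq_mul_right_iff.1 (h.coeff_eq hf hlam i)).resolve_left (hcon i), zero_mul]
  · rintro ⟨i, rfl⟩
    refine ⟨e i, h.memLp i, fun hz => ?_, ae_of_all _ (h.integral_kernel_mul_self i)⟩
    have h1 : ∫ x, e i x * e i x ∂μ = 1 := by simp [h.orthonormal]
    rw [integral_eq_zero_of_ae] at h1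
    · exact zero_ne_one h1
    · filter_upwards [hz] with x hx
      simp [hx]

/-- An `L²` function orthogonal to the family is in the kernel of the operator. -/
theorem isEigenvalue_zero (h : IsOrthonormalExpansion μ W a e) {f : Ω → ℝ}
    (hf : MemLp f 2 μ) (hne : ¬ f =ᵐ[μ] 0) (horth : ∀ i, ∫ x, e i x * f x ∂μ = 0) :
    IsEigenvalue μ W 0 :=
  ⟨f, hf, hne, ae_of_all _ fun x => by simp [h.integral_kernel_mul hf, horth]⟩

theorem hasEigenFamily_iff (h : IsOrthonormalExpansion μ W a e) {lam : ℝ} (h0 : lam ≠ 0)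
    (n : ℕ) : HasEigenFamily μ W lam n ↔ n ≤ (Finset.univ.filter fun i => a i = lam).card := by
  constructor
  · rintro ⟨f, hf, hlam, hind⟩
    set S := Finset.univ.filter fun i => a i = lam with hS
    let coeff : Fin n → S → ℝ := fun j i => ∫ y, e i y * f j y ∂μ
    have hli : LinearIndependent ℝ coeff := by
      rw [Fintype.linearIndependent_iff]
      intro c hc
      refine congrFun (hind c ?_)
      have hall : ∀ᵐ x ∂μ, ∀ j, f j x = ∑ i, (∫ y, e i y * f j y ∂μ) * e i x :=
        ae_all_iff.2 fun j => h.eigenfunction_ae_eq h0 (hf j) (hlam j)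
      filter_upwards [hall] with x hx
      simp_rw [hx, Finset.mul_sum]
      rw [Finset.sum_comm]
      refine Finset.sum_eq_zero fun i _ => ?_
      simp_rw [← mul_assoc, ← Finset.sum_mul]
      by_cases hi : a i = lam
      · have := congrFun hc ⟨i, by simp [hS, hi]⟩
        simp only [Finset.sum_apply, Pi.smul_apply, smul_eq_mul, Pi.zero_apply, coeff] at this
        rw [this, zero_mul]
      · rw [Finset.sum_eq_zero, zero_mul]
        intro j _
        rw [(mul_eq_mul_right_iff.1 (h.coeff_eq (hf j) (hlam j) i)).resolve_left hi, mul_zero]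
    simpa using hli.fintype_card_le_finrank
  · intro hn
    obtain ⟨g⟩ : Nonempty (Fin n ↪ (Finset.univ.filter fun i => a i = lam)) :=
      Function.Embedding.nonempty_of_card_le (by
        rwa [Fintype.card_fin, Fintype.card_coe])
    have hg : Function.Injective fun j => (g j : ι) := Subtype.val_injective.comp g.injective
    refine ⟨fun j => e (g j), fun j => h.memLp _, fun j => ae_of_all _ fun x => ?_,
      fun c hc => ?_⟩
    · rw [h.integral_kernel_mul_self, (Finset.mem_filter.1 (g j).2).2]
    · funext k
      have hk := h.integral_mul_sum (fun i => ∑ j, if (g j : ι) = i then c j else 0) (g k)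
      rw [integral_eq_zero_of_ae] at hk
      · simpa [hg.eq_iff] using hk.symm
      · filter_upwards [hc] with x hx
        simp [Finset.sum_mul, Finset.sum_comm (s := (Finset.univ : Finset ι)), hx]

end IsOrthonormalExpansion

/-- The action of a linear isometry on the unit sphere. -/
noncomputable def sphereMap {d : ℕ} (g : EuclideanSpace ℝ (Fin d) ≃ₗᵢ[ℝ] EuclideanSpace ℝ (Fin d))
    (x : Metric.sphere (0 : EuclideanSpace ℝ (Fin d)) 1) :
    Metric.sphere (0 : EuclideanSpace ℝ (Fin d)) 1 :=
  ⟨g x, by simp⟩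

theorem continuous_sphereMap {d : ℕ}
    (g : EuclideanSpace ℝ (Fin d) ≃ₗᵢ[ℝ] EuclideanSpace ℝ (Fin d)) :
    Continuous (sphereMap g) :=
  (g.continuous.comp continuous_subtype_val).subtype_mk _

theorem isClosedEmbedding_sphereMap {d : ℕ}
    (g : EuclideanSpace ℝ (Fin d) ≃ₗᵢ[ℝ] EuclideanSpace ℝ (Fin d)) :
    Topology.IsClosedEmbedding (sphereMap g) :=
  (continuous_sphereMap g).isClosedEmbedding fun _ _ hxy =>
    Subtype.ext (g.injective (congrArg Subtype.val hxy))

theorem measurePreserving_sphereMap {d : ℕ}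
    (g : EuclideanSpace ℝ (Fin d) ≃ₗᵢ[ℝ] EuclideanSpace ℝ (Fin d)) :
    MeasurePreserving (sphereMap g) (sphereUniform d) (sphereUniform d) := by
  have hm := (continuous_sphereMap g).measurable
  refine ⟨hm, Measure.ext fun s hs => ?_⟩
  rw [Measure.map_apply hm hs, sphereUniform, Measure.smul_apply, Measure.smul_apply,
    Measure.toSphere_apply' _ (hm hs), Measure.toSphere_apply' _ hs]
  have hset : Set.Ioo (0 : ℝ) 1 • (Subtype.val '' (sphereMap g ⁻¹' s)) =
      g ⁻¹' (Set.Ioo (0 : ℝ) 1 • (Subtype.val '' s)) := by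
    ext x
    simp only [Set.mem_preimage, Set.mem_smul, Set.mem_image]
    constructor
    · rintro ⟨r, hr, _, ⟨y, hy, rfl⟩, rfl⟩
      exact ⟨r, hr, _, ⟨_, hy, rfl⟩, by simp [sphereMap]⟩
    · rintro ⟨r, hr, _, ⟨y, hy, rfl⟩, hx⟩
      refine ⟨r, hr, _, ⟨sphereMap g.symm y, ?_, rfl⟩, ?_⟩
      · simpa [sphereMap] using hy
      · simp [sphereMap, ← map_smul, hx]
  rw [hset, g.measurePreserving.measure_preimage_emb
    g.toHomeomorph.measurableEmbedding]

theorem integral_comp_sphereMap {d : ℕ}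
    (g : EuclideanSpace ℝ (Fin d) ≃ₗᵢ[ℝ] EuclideanSpace ℝ (Fin d))
    (F : Metric.sphere (0 : EuclideanSpace ℝ (Fin d)) 1 → ℝ) :
    ∫ x, F (sphereMap g x) ∂sphereUniform d = ∫ x, F x ∂sphereUniform d :=
  (measurePreserving_sphereMap g).integral_comp
    (isClosedEmbedding_sphereMap g).measurableEmbedding F

theorem integral_eq_zero_of_comp_sphereMap_eq_neg {d : ℕ}
    (g : EuclideanSpace ℝ (Fin d) ≃ₗᵢ[ℝ] EuclideanSpace ℝ (Fin d))
    {F : Metric.sphere (0 : EuclideanSpace ℝ (Fin d)) 1 → ℝ}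
    (hF : ∀ x, F (sphereMap g x) = -F x) : ∫ x, F x ∂sphereUniform d = 0 := by
  have h := integral_comp_sphereMap g F
  simp_rw [hF, integral_neg] at h
  linarith

instance isProbabilityMeasure_sphereUniform (d : ℕ) [NeZero d] :
    IsProbabilityMeasure (sphereUniform d) := by
  refine ⟨?_⟩
  rw [sphereUniform, Measure.smul_apply, smul_eq_mul]
  refine ENNReal.inv_mul_cancel ?_ (measure_ne_top _ _)
  rw [Measure.measure_univ_ne_zero]
  exact Measure.toSphere_ne_zero _

instance isOpenPosMeasure_sphereUniform (d : ℕ) : (sphereUniform d).IsOpenPosMeasure :=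
  Measure.isOpenPosMeasure_smul _ (ENNReal.inv_ne_zero.2 (measure_ne_top _ _))

theorem memLp_sphereUniform_of_continuous {d : ℕ} [NeZero d]
    {F : Metric.sphere (0 : EuclideanSpace ℝ (Fin d)) 1 → ℝ} (hF : Continuous F) :
    MemLp F 2 (sphereUniform d) :=
  hF.memLp_of_hasCompactSupport (HasCompactSupport.of_compactSpace F)

theorem not_ae_eq_zero_sphereUniform {d : ℕ}
    {F : Metric.sphere (0 : EuclideanSpace ℝ (Fin d)) 1 → ℝ} (hF : Continuous F)
    (x : Metric.sphere (0 : EuclideanSpace ℝ (Fin d)) 1) (hx : F x ≠ 0) :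
    ¬ F =ᵐ[sphereUniform d] 0 := fun h =>
  hx (congrFun (hF.ae_eq_iff_eq _ continuous_zero |>.1 h) x)

theorem sum_sq_sphere {d : ℕ} (x : Metric.sphere (0 : EuclideanSpace ℝ (Fin d)) 1) :
    ∑ i, x.1 i ^ 2 = 1 := by
  have h : ‖x.1‖ ^ 2 = 1 := by simp
  rw [EuclideanSpace.norm_sq_eq] at h
  simpa only [Real.norm_eq_abs, sq_abs] using h

theorem continuous_coord {d : ℕ} (i : Fin d) :
    Continuous fun x : Metric.sphere (0 : EuclideanSpace ℝ (Fin d)) 1 => x.1 i := by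
  fun_prop

/-- The reflection that changes the sign of the `k`-th coordinate. -/
noncomputable def coordReflection {d : ℕ} (k : Fin d) :
    EuclideanSpace ℝ (Fin d) ≃ₗᵢ[ℝ] EuclideanSpace ℝ (Fin d) :=
  LinearIsometryEquiv.piLpCongrRight 2 fun i =>
    if i = k then LinearIsometryEquiv.neg ℝ else LinearIsometryEquiv.refl ℝ ℝ

@[simp]
theorem sphereMap_coordReflection_apply {d : ℕ} (k i : Fin d)
    (x : Metric.sphere (0 : EuclideanSpace ℝ (Fin d)) 1) :
    (sphereMap (coordReflection k) x).1 i = if i = k then -x.1 i else x.1 i := by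
  simp only [sphereMap, coordReflection, LinearIsometryEquiv.piLpCongrRight_apply]
  split_ifs <;> simp

/-- The permutation of coordinates exchanging `i` and `j`. -/
noncomputable def coordSwap {d : ℕ} (i j : Fin d) :
    EuclideanSpace ℝ (Fin d) ≃ₗᵢ[ℝ] EuclideanSpace ℝ (Fin d) :=
  LinearIsometryEquiv.piLpCongrLeft 2 ℝ ℝ (Equiv.swap i j)

@[simp]
theorem sphereMap_coordSwap_apply {d : ℕ} (i j k : Fin d)
    (x : Metric.sphere (0 : EuclideanSpace ℝ (Fin d)) 1) :
    (sphereMap (coordSwap i j) x).1 k = x.1 (Equiv.swap i j k) := by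
  simp [sphereMap, coordSwap, LinearIsometryEquiv.piLpCongrLeft_apply, Equiv.piCongrLeft'_apply]

/-- The rotation of the plane by an eighth of a turn. -/
noncomputable def rotationEighth :
    EuclideanSpace ℝ (Fin 2) ≃ₗᵢ[ℝ] EuclideanSpace ℝ (Fin 2) :=
  LinearIsometry.toLinearIsometryEquiv
    { toFun := fun v => !₂[√(1 / 2) * (v 0 + v 1), √(1 / 2) * (v 1 - v 0)]
      map_add' := fun v w => by
        ext i; fin_cases i <;> simp <;> ring
      map_smul' := fun r v => by
        ext i; fin_cases i <;> simp <;> ring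
      norm_map' := fun v => by
        have h : √(1 / 2 : ℝ) ^ 2 = 1 / 2 := Real.sq_sqrt (by norm_num)
        simp only [LinearMap.coe_mk, AddHom.coe_mk, EuclideanSpace.norm_eq, Fin.sum_univ_two,
          Real.norm_eq_abs, sq_abs]
        congr 1
        simp only [Matrix.cons_val_zero, Matrix.cons_val_one]
        linear_combination (2 * v 0 ^ 2 + 2 * v 1 ^ 2) * h }
    rfl

theorem sphereMap_rotationEighth_zero (x : Metric.sphere (0 : EuclideanSpace ℝ (Fin 2)) 1) :
    (sphereMap rotationEighth x).1 0 = √(1 / 2) * (x.1 0 + x.1 1) := rfl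

theorem sphereMap_rotationEighth_one (x : Metric.sphere (0 : EuclideanSpace ℝ (Fin 2)) 1) :
    (sphereMap rotationEighth x).1 1 = √(1 / 2) * (x.1 1 - x.1 0) := rfl

theorem integrable_sphereUniform_of_continuous {d : ℕ} [NeZero d]
    {F : Metric.sphere (0 : EuclideanSpace ℝ (Fin d)) 1 → ℝ} (hF : Continuous F) :
    Integrable F (sphereUniform d) :=
  (memLp_sphereUniform_of_continuous hF).integrable (by norm_num)

theorem integral_coord_sq {d : ℕ} [NeZero d] (i : Fin d) :
    ∫ x, x.1 i ^ 2 ∂sphereUniform d = 1 / d := by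
  have hswap : ∀ j, ∫ x, x.1 j ^ 2 ∂sphereUniform d = ∫ x, x.1 i ^ 2 ∂sphereUniform d :=
    fun j => by
      have h := integral_comp_sphereMap (coordSwap i j) fun x => x.1 i ^ 2
      simpa using h
  have hsum : ∑ j, ∫ x, x.1 j ^ 2 ∂sphereUniform d = 1 := by
    rw [← integral_finsetSum _ fun j _ =>
      integrable_sphereUniform_of_continuous (by fun_prop)]
    simp [sum_sq_sphere]
  simp only [hswap, Finset.sum_const, Finset.card_univ, Fintype.card_fin, nsmul_eq_mul] at hsum
  rw [eq_div_iff (Nat.cast_ne_zero.2 (NeZero.ne d)), mul_comm, hsum]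

theorem sq_add_sq_circle (x : Metric.sphere (0 : EuclideanSpace ℝ (Fin 2)) 1) :
    x.1 0 ^ 2 + x.1 1 ^ 2 = 1 := by
  simpa [Fin.sum_univ_two] using sum_sq_sphere x

theorem integral_sq_sub_sq_sq_circle :
    ∫ x, (x.1 0 ^ 2 - x.1 1 ^ 2) ^ 2 ∂sphereUniform 2 = 1 / 2 ∧
      ∫ x, (2 * (x.1 0 * x.1 1)) ^ 2 ∂sphereUniform 2 = 1 / 2 := by
  have hrot := integral_comp_sphereMap rotationEighth fun x => (x.1 0 ^ 2 - x.1 1 ^ 2) ^ 2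
  have h2 : √(1 / 2 : ℝ) ^ 2 = 1 / 2 := Real.sq_sqrt (by norm_num)
  simp only [sphereMap_rotationEighth_zero, sphereMap_rotationEighth_one, mul_pow, h2] at hrot
  have heq : ∀ x : Metric.sphere (0 : EuclideanSpace ℝ (Fin 2)) 1,
      (1 / 2 * (x.1 0 + x.1 1) ^ 2 - 1 / 2 * (x.1 1 - x.1 0) ^ 2) ^ 2 =
        (2 * (x.1 0 * x.1 1)) ^ 2 := fun x => by ring
  simp_rw [heq] at hrot
  have hc0 := continuous_coord (0 : Fin 2)
  have hc1 := continuous_coord (1 : Fin 2)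
  have hsum : ∫ x, (x.1 0 ^ 2 - x.1 1 ^ 2) ^ 2 ∂sphereUniform 2 +
      ∫ x, (2 * (x.1 0 * x.1 1)) ^ 2 ∂sphereUniform 2 = 1 := by
    rw [← integral_add (integrable_sphereUniform_of_continuous (by fun_prop))
      (integrable_sphereUniform_of_continuous (by fun_prop))]
    have hone : ∀ x : Metric.sphere (0 : EuclideanSpace ℝ (Fin 2)) 1,
        (x.1 0 ^ 2 - x.1 1 ^ 2) ^ 2 + (2 * (x.1 0 * x.1 1)) ^ 2 = 1 := fun x => by
      linear_combination (x.1 0 ^ 2 + x.1 1 ^ 2 + 1) * sq_add_sq_circle x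
    simp [hone]
  constructor <;> linarith

/-- The eigenvalues of both graphons, listed with multiplicity. -/
noncomputable def graphonSpectrum : Fin 5 → ℝ := Fin.cons (1 / 2) fun _ => 1 / 16

/-- Eigenfunctions of `WS3`: the constant and the normalized coordinates. -/
noncomputable def eigenS3 :
    Fin 5 → Metric.sphere (0 : EuclideanSpace ℝ (Fin 4)) 1 → ℝ :=
  Fin.cons (fun _ => 1) fun i x => 2 * x.1 i

/-- Eigenfunctions of `WS1`: the trigonometric polynomials of degree at most two. -/
noncomputable def eigenS1 :
    Fin 5 → Metric.sphere (0 : EuclideanSpace ℝ (Fin 2)) 1 → ℝ :=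
  ![fun _ => 1, fun x => √2 * x.1 0, fun x => √2 * x.1 1,
    fun x => √2 * (x.1 0 ^ 2 - x.1 1 ^ 2), fun x => √2 * (2 * (x.1 0 * x.1 1))]

theorem WS3_isOrthonormalExpansion :
    IsOrthonormalExpansion (sphereUniform 4) WS3 graphonSpectrum eigenS3 where
  memLp i := by
    refine memLp_sphereUniform_of_continuous ?_
    refine Fin.cases ?_ (fun i => ?_) i <;> simp only [eigenS3, Fin.cons_zero, Fin.cons_succ] <;>
      fun_prop
  orthonormal i j := by
    have hlin : ∀ i : Fin 4, ∫ x, 2 * x.1 i ∂sphereUniform 4 = 0 := fun i =>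
      integral_eq_zero_of_comp_sphereMap_eq_neg (coordReflection i) fun x => by simp
    refine Fin.cases ?_ (fun i => ?_) i <;> refine Fin.cases ?_ (fun j => ?_) j <;>
      simp only [eigenS3, Fin.cons_zero, Fin.cons_succ]
    · simp
    · simpa [(Fin.succ_ne_zero j).symm] using hlin j
    · simpa [Fin.succ_ne_zero i] using hlin i
    · rcases eq_or_ne i j with rfl | hij
      · have hsq : ∀ x : Metric.sphere (0 : EuclideanSpace ℝ (Fin 4)) 1,
            2 * x.1 i * (2 * x.1 i) = 4 * x.1 i ^ 2 := fun x => by ring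
        simp_rw [hsq]
        rw [integral_const_mul, integral_coord_sq]
        norm_num
      · rw [if_neg (by simpa using hij)]
        exact integral_eq_zero_of_comp_sphereMap_eq_neg (coordReflection i) fun x => by
          simp [hij.symm]
  kernel_eq x y := by
    simp only [WS3, graphonSpectrum, eigenS3, Fin.sum_univ_succ (n := 4), Fin.cons_zero,
      Fin.cons_succ, PiLp.inner_apply, Fin.sum_univ_four]
    simp
    ring

theorem WS1_isOrthonormalExpansion :
    IsOrthonormalExpansion (sphereUniform 2) WS1 graphonSpectrum eigenS1 where
  memLp i := by
    refine memLp_sphereUniform_of_continuous ?_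
    fin_cases i <;> simp [eigenS1] <;> fun_prop
  orthonormal i j := by
    have h2 : √(2 : ℝ) ^ 2 = 2 := Real.sq_sqrt (by norm_num)
    have hdiag : ∀ F : Metric.sphere (0 : EuclideanSpace ℝ (Fin 2)) 1 → ℝ,
        ∫ x, F x ^ 2 ∂sphereUniform 2 = 1 / 2 →
          ∫ x, √2 * F x * (√2 * F x) ∂sphereUniform 2 = 1 := fun F hF => by
      have hsq : ∀ x, √2 * F x * (√2 * F x) = 2 * F x ^ 2 := fun x => by
        linear_combination F x ^ 2 * h2
      simp_rw [hsq]
      rw [integral_const_mul, hF]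
      norm_num
    rcases eq_or_ne i j with rfl | hij
    · rw [if_pos rfl]
      fin_cases i
      · simp [eigenS1]
      · exact hdiag _ (by simpa using integral_coord_sq (0 : Fin 2))
      · exact hdiag _ (by simpa using integral_coord_sq (1 : Fin 2))
      · exact hdiag _ integral_sq_sub_sq_sq_circle.1
      · exact hdiag _ integral_sq_sub_sq_sq_circle.2
    · rw [if_neg hij]
      fin_cases i <;> fin_cases j <;> first
        | exact absurd rfl hij
        | (refine integral_eq_zero_of_comp_sphereMap_eq_neg (coordReflection 0) fun x => ?_
           simp [eigenS1]
           done)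
        | (refine integral_eq_zero_of_comp_sphereMap_eq_neg (coordReflection 1) fun x => ?_
           simp [eigenS1]
           done)
        | (refine integral_eq_zero_of_comp_sphereMap_eq_neg (coordSwap 0 1) fun x => ?_
           simp [eigenS1]
           ring)
  kernel_eq x y := by
    have h2 : √(2 : ℝ) ^ 2 = 2 := Real.sq_sqrt (by norm_num)
    have habs : |⟪x.1, y.1⟫| ≤ 1 := by
      simpa using abs_real_inner_le_norm x.1 y.1
    have hcos : Real.cos (geodesic x y) = x.1 0 * y.1 0 + x.1 1 * y.1 1 := by
      rw [geodesic, Real.cos_arccos (abs_le.1 habs).1 (abs_le.1 habs).2]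
      simp [PiLp.inner_apply, Fin.sum_univ_two]
      ring
    rw [WS1, Real.cos_two_mul, hcos, Fin.sum_univ_five]
    have hx := sq_add_sq_circle x
    have hy := sq_add_sq_circle y
    have ha : ∀ i : Fin 4, graphonSpectrum i.succ = 1 / 16 := fun i => rfl
    rw [show graphonSpectrum 0 = 1 / 2 from rfl, show graphonSpectrum 1 = 1 / 16 from ha 0,
      show graphonSpectrum 2 = 1 / 16 from ha 1, show graphonSpectrum 3 = 1 / 16 from ha 2,
      show graphonSpectrum 4 = 1 / 16 from ha 3]
    simp only [eigenS1, Matrix.cons_val]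
    linear_combination (x.1 0 * y.1 0 + x.1 1 * y.1 1) * (-1 / 16) * h2
      - 1 / 16 * ((x.1 0 ^ 2 - x.1 1 ^ 2) * (y.1 0 ^ 2 - y.1 1 ^ 2) +
        4 * (x.1 0 * x.1 1 * (y.1 0 * y.1 1))) * h2
      + 1 / 8 * (y.1 0 ^ 2 + y.1 1 ^ 2) * hx + 1 / 8 * hy

theorem exists_graphonSpectrum_eq_iff (lam : ℝ) :
    (∃ i, graphonSpectrum i = lam) ↔ lam = 1 / 2 ∨ lam = 1 / 16 := by
  simp [graphonSpectrum, Fin.exists_fin_succ, eq_comm]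

theorem card_graphonSpectrum_eq_half :
    (Finset.univ.filter fun i => graphonSpectrum i = 1 / 2).card = 1 := by
  simp [Finset.card_filter, graphonSpectrum, Fin.sum_univ_succ (n := 4)]

theorem card_graphonSpectrum_eq_sixteenth :
    (Finset.univ.filter fun i => graphonSpectrum i = 1 / 16).card = 4 := by
  simp [Finset.card_filter, graphonSpectrum, Fin.sum_univ_succ (n := 4)]

theorem WS1_isEigenvalue_zero : IsEigenvalue (sphereUniform 2) WS1 0 := by
  have hcont : Continuous fun x : Metric.sphere (0 : EuclideanSpace ℝ (Fin 2)) 1 =>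
      x.1 0 * x.1 1 * (x.1 0 ^ 2 - x.1 1 ^ 2) := by fun_prop
  refine WS1_isOrthonormalExpansion.isEigenvalue_zero (memLp_sphereUniform_of_continuous hcont)
    (not_ae_eq_zero_sphereUniform hcont ⟨!₂[3 / 5, 4 / 5], ?_⟩ ?_) fun i => ?_
  · rw [mem_sphere_zero_iff_norm, EuclideanSpace.norm_eq, Fin.sum_univ_two]
    norm_num
  · norm_num
  · fin_cases i <;> first
      | (refine integral_eq_zero_of_comp_sphereMap_eq_neg (coordReflection 0) fun x => ?_
         simp [eigenS1]
         done)
      | (refine integral_eq_zero_of_comp_sphereMap_eq_neg (coordReflection 1) fun x => ?_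
         simp [eigenS1]
         done)
      | (refine integral_eq_zero_of_comp_sphereMap_eq_neg (coordSwap 0 1) fun x => ?_
         simp [eigenS1]
         ring)

theorem WS3_isEigenvalue_zero : IsEigenvalue (sphereUniform 4) WS3 0 := by
  have hcont : Continuous fun x : Metric.sphere (0 : EuclideanSpace ℝ (Fin 4)) 1 =>
      x.1 0 * x.1 1 := by fun_prop
  refine WS3_isOrthonormalExpansion.isEigenvalue_zero (memLp_sphereUniform_of_continuous hcont)
    (not_ae_eq_zero_sphereUniform hcont ⟨!₂[3 / 5, 4 / 5, 0, 0], ?_⟩ ?_) fun i => ?_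
  · rw [mem_sphere_zero_iff_norm, EuclideanSpace.norm_eq, Fin.sum_univ_four]
    change √(‖(3 / 5 : ℝ)‖ ^ 2 + ‖(4 / 5 : ℝ)‖ ^ 2 + ‖(0 : ℝ)‖ ^ 2 + ‖(0 : ℝ)‖ ^ 2) = 1
    norm_num
  · norm_num
  · refine Fin.cases ?_ (fun i => ?_) i
    · exact integral_eq_zero_of_comp_sphereMap_eq_neg (coordReflection 0) fun x => by
        simp [eigenS3]
    · rcases eq_or_ne i 0 with rfl | hi
      · exact integral_eq_zero_of_comp_sphereMap_eq_neg (coordReflection 1) fun x => by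
          simp [eigenS3]
      · exact integral_eq_zero_of_comp_sphereMap_eq_neg (coordReflection 0) fun x => by
          simp [eigenS3, hi]

theorem isEigenvalue_iff_of_graphonSpectrum {Ω : Type*} [MeasurableSpace Ω] {μ : Measure Ω}
    {W : Ω → Ω → ℝ} {e : Fin 5 → Ω → ℝ} (h : IsOrthonormalExpansion μ W graphonSpectrum e)
    (hzero : IsEigenvalue μ W 0) (lam : ℝ) :
    IsEigenvalue μ W lam ↔ (lam = 0 ∨ lam = 1 / 2 ∨ lam = 1 / 16) := by
  rcases eq_or_ne lam 0 with rfl | h0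
  · simpa using hzero
  · rw [h.isEigenvalue_iff h0, exists_graphonSpectrum_eq_iff]
    simp [h0]

/-- the graphons `W_{S¹}` on the circle and `W_{S³}` on `S³` are isospectral:
the set of eigenvalues of both integral operators is `{0, 1/2, 1/16}`, and for every
nonzero eigenvalue the eigenspaces have equal dimensions (`1` for `1/2`, `4` for `1/16`). -/
theorem WS1_WS3_isospectral :
    (∀ lam : ℝ, IsEigenvalue (sphereUniform 2) WS1 lam ↔
      (lam = 0 ∨ lam = 1 / 2 ∨ lam = 1 / 16)) ∧
    (∀ lam : ℝ, IsEigenvalue (sphereUniform 4) WS3 lam ↔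
      (lam = 0 ∨ lam = 1 / 2 ∨ lam = 1 / 16)) ∧
    (HasEigenFamily (sphereUniform 2) WS1 (1 / 2) 1 ∧
      ¬ HasEigenFamily (sphereUniform 2) WS1 (1 / 2) 2 ∧
      HasEigenFamily (sphereUniform 4) WS3 (1 / 2) 1 ∧
      ¬ HasEigenFamily (sphereUniform 4) WS3 (1 / 2) 2) ∧
    (HasEigenFamily (sphereUniform 2) WS1 (1 / 16) 4 ∧
      ¬ HasEigenFamily (sphereUniform 2) WS1 (1 / 16) 5 ∧
      HasEigenFamily (sphereUniform 4) WS3 (1 / 16) 4 ∧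
      ¬ HasEigenFamily (sphereUniform 4) WS3 (1 / 16) 5) := by
  have half : (1 / 2 : ℝ) ≠ 0 := by norm_num
  have sixteenth : (1 / 16 : ℝ) ≠ 0 := by norm_num
  refine ⟨isEigenvalue_iff_of_graphonSpectrum WS1_isOrthonormalExpansion WS1_isEigenvalue_zero,
    isEigenvalue_iff_of_graphonSpectrum WS3_isOrthonormalExpansion WS3_isEigenvalue_zero, ?_, ?_⟩
  · simp only [WS1_isOrthonormalExpansion.hasEigenFamily_iff half,
      WS3_isOrthonormalExpansion.hasEigenFamily_iff half, card_graphonSpectrum_eq_half]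
    norm_num
  · simp only [WS1_isOrthonormalExpansion.hasEigenFamily_iff sixteenth,
      WS3_isOrthonormalExpansion.hasEigenFamily_iff sixteenth, card_graphonSpectrum_eq_sixteenth]
    norm_num
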